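/- For every integer n ≥ 0, Q(n) + 2 Σ_{j=1}^{∞} (−1)^j Q(n − j²) equals (−1)^{T_m} if n = G_m for some (necessarily unique) integer m ≥ 0, and equals 0 otherwise; the sum is finite since Q vanishes on negative arguments. -/

import Mathlib

/-- The `n`-th triangular number `T n = n(n+1)/2`. -/
def T (n : ℕ) : ℕ := n * (n + 1) / 2

/-- The `n`-th generalized pentagonal number `G n = T n - T ⌊n/2⌋`. -/
def G (n : ℕ) : ℕ := T n - T (n / 2)

/-- The number of partitions of `n` into distinct parts, vanishing on negative integers. -/
def Q (n : ℤ) : ℤ :=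
  if 0 ≤ n then ((Nat.Partition.distincts n.toNat).card : ℤ) else 0

open Classical in
/-- `ε(n) = (-1)^(T m)` if `n = G m` for the (unique) `m`, and `0` otherwise. -/
noncomputable def eps (n : ℕ) : ℤ := if h : ∃ m, n = G m then (-1) ^ (T h.choose) else 0

open Finset PowerSeries Filter
open scoped PowerSeries.WithPiTopology

section PartialTheta

variable {R : Type*} [CommRing R] (x : R)

/-- The finite product `∏ (1 - x ^ i)` over `a ≤ i < a + L`. -/
def prodOneSub (a L : ℕ) : R := ∏ i ∈ range L, (1 - x ^ (a + i))

/-- The finite product `∏ (1 + x ^ i)` over `a ≤ i < a + L`. -/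
def prodOneAdd (a L : ℕ) : R := ∏ i ∈ range L, (1 + x ^ (a + i))

/-- The truncated theta series `∑ (-1) ^ j * x ^ (j ^ 2)` over `-k ≤ j ≤ k`. -/
def partialTheta (k : ℕ) : R := 1 + 2 * ∑ j ∈ range k, (-1) ^ (j + 1) * x ^ ((j + 1) ^ 2)

/-- The sum `∑ x ^ ((k + 1) * j) * prodOneSub x (k + 1) j * prodOneAdd x (k + j + 2) (L - 1 - j)`
over `j < L`, which measures the error of truncating the theta series. -/
def thetaRemainder (k : ℕ) : ℕ → R
  | 0 => 0
  | L + 1 => (1 + x ^ (k + 1 + L)) * thetaRemainder k L + x ^ ((k + 1) * L) * prodOneSub x (k + 1) L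

theorem prodOneSub_succ (a L : ℕ) :
    prodOneSub x a (L + 1) = prodOneSub x a L * (1 - x ^ (a + L)) := prod_range_succ _ _

theorem prodOneSub_succ' (a L : ℕ) :
    prodOneSub x a (L + 1) = (1 - x ^ a) * prodOneSub x (a + 1) L := by
  simp only [prodOneSub, prod_range_succ', add_zero, mul_comm (1 - x ^ a)]
  congr! 4
  ring

theorem prodOneAdd_succ (a L : ℕ) :
    prodOneAdd x a (L + 1) = prodOneAdd x a L * (1 + x ^ (a + L)) := prod_range_succ _ _

theorem prodOneAdd_add (a k L : ℕ) :
    prodOneAdd x a (k + L) = prodOneAdd x a k * prodOneAdd x (a + k) L := by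
  simp only [prodOneAdd, prod_range_add, add_assoc]

theorem thetaRemainder_succ_add (k L : ℕ) :
    thetaRemainder x k (L + 1) + x ^ (2 * k + 3) * (1 + x ^ (k + 1)) * thetaRemainder x (k + 1) L =
      (1 + x ^ (k + 1)) * prodOneAdd x (k + 2) L
        - x ^ ((k + 1) * (L + 1)) * prodOneSub x (k + 2) L := by
  induction L with
  | zero => simp [thetaRemainder, prodOneAdd, prodOneSub]
  | succ L ih =>
    rw [thetaRemainder, thetaRemainder.eq_2 x (k + 1) L, prodOneAdd_succ, prodOneSub_succ',
      prodOneSub_succ]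
    linear_combination (1 + x ^ (k + 2 + L)) * ih

theorem prodOneAdd_one_eq (L : ℕ) :
    prodOneAdd x 1 L = prodOneSub x 1 L + 2 * x * thetaRemainder x 0 L := by
  induction L with
  | zero => simp [thetaRemainder, prodOneAdd, prodOneSub]
  | succ L ih =>
    rw [prodOneAdd_succ, prodOneSub_succ, thetaRemainder]
    linear_combination (1 + x ^ (1 + L)) * ih

theorem pow_dvd_partialTheta_mul_sub (k L : ℕ) :
    x ^ (k + L + 1) ∣ partialTheta x k * prodOneAdd x 1 (k + L) - prodOneSub x 1 (k + L)
      - 2 * (-1) ^ k * x ^ ((k + 1) ^ 2) * prodOneAdd x 1 k * thetaRemainder x k L := by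
  induction k generalizing L with
  | zero =>
    have hD : prodOneAdd x 1 0 = 1 := prod_range_zero _
    simp [partialTheta, prodOneAdd_one_eq x L, hD]
  | succ k ih =>
    have h := ih (L + 1)
    rw [show k + (L + 1) = k + 1 + L by ring] at h
    have hd : x ^ (k + 1 + L + 1) ∣ 2 * (-1) ^ k * prodOneAdd x 1 k * prodOneSub x (k + 2) L *
        x ^ ((k + 1) * (k + 1 + L + 1)) :=
      Dvd.dvd.mul_left (pow_dvd_pow x (Nat.le_mul_of_pos_left _ k.succ_pos)) _
    convert dvd_sub h hd using 1
    have hθ : partialTheta x (k + 1) =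
        partialTheta x k + 2 * ((-1) ^ (k + 1) * x ^ ((k + 1) ^ 2)) := by
      simp only [partialTheta, sum_range_succ]; ring
    have hD := prodOneAdd_add x 1 (k + 1) L
    have hD' := prodOneAdd_succ x 1 k
    rw [show 1 + (k + 1) = k + 2 by ring] at hD
    rw [hθ, pow_succ (-1 : R) k]
    linear_combination (-2) * (-1) ^ k * x ^ ((k + 1) ^ 2) * hD
      - 2 * (-1) ^ k * x ^ ((k + 1) ^ 2) * (prodOneAdd x (k + 2) L
        - x ^ (2 * k + 3) * thetaRemainder x (k + 1) L) * hD'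
      + 2 * (-1) ^ k * x ^ ((k + 1) ^ 2) * prodOneAdd x 1 k * thetaRemainder_succ_add x k L

/-- A finite form of Gauss's identity `∑ (-1) ^ j x ^ (j ^ 2) = ∏ (1 - x ^ i) / (1 + x ^ i)`. -/
theorem pow_dvd_partialTheta_mul_prodOneAdd_sub (N : ℕ) :
    x ^ (N + 1) ∣ partialTheta x N * prodOneAdd x 1 N - prodOneSub x 1 N := by
  simpa [thetaRemainder] using pow_dvd_partialTheta_mul_sub x N 0

end PartialTheta

theorem coeff_prodOneAdd_eventually_eq (n : ℕ) :
    ∀ᶠ N in atTop, (prodOneAdd (X : ℤ⟦X⟧) 1 N).coeff n = Q n := by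
  have h := (Nat.Partition.hasProd_powerSeriesMk_card_countRestricted ℤ
    two_pos).tendsto_prod_nat
  rw [WithPiTopology.tendsto_iff_coeff_tendsto] at h
  have hn := h n
  rw [nhds_discrete, tendsto_pure] at hn
  filter_upwards [hn] with N hN
  rw [coeff_mk, Nat.Partition.countRestricted_two] at hN
  have hprod : prodOneAdd (X : ℤ⟦X⟧) 1 N = ∏ i ∈ range N, ∑ j ∈ range 2, X ^ ((i + 1) * j) :=
    prod_congr rfl fun i _ ↦ by simp [sum_range_succ, add_comm]
  rw [hprod, hN]
  simp [Q]

theorem coeff_prodOneSub_eventually_eq (n : ℕ) :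
    ∀ᶠ N in atTop, (prodOneSub (X : ℤ⟦X⟧) 1 N).coeff n = (pentagonalSeries ℤ).coeff n := by
  filter_upwards [tendsto_finset_range.eventually
    (coeff_prod_one_sub_X_pow_eventually_eq ℤ n)] with N hN
  simpa [prodOneSub, add_comm] using hN

theorem T_two_mul (l : ℕ) : T (2 * l) = l * (2 * l + 1) := by
  rw [T, mul_assoc, Nat.mul_div_cancel_left _ two_pos]

theorem T_two_mul_add_one (l : ℕ) : T (2 * l + 1) = (2 * l + 1) * (l + 1) := by
  rw [T, show (2 * l + 1) * (2 * l + 1 + 1) = 2 * ((2 * l + 1) * (l + 1)) by ring,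
    Nat.mul_div_cancel_left _ two_pos]

theorem two_mul_T (n : ℕ) : 2 * T n = n * (n + 1) :=
  Nat.mul_div_cancel' (Nat.even_mul_succ_self n).two_dvd

theorem G_two_mul (l : ℕ) : G (2 * l) = pentagonal (-l) := by
  have h1 := two_mul_T l
  have h2 := two_mul_natCast_pentagonal_neg l
  rw [G, T_two_mul, Nat.mul_div_cancel_left _ two_pos, Nat.sub_eq_iff_eq_add (by nlinarith)]
  zify at h1 ⊢
  linarith

theorem G_two_mul_add_one (l : ℕ) : G (2 * l + 1) = pentagonal (l + 1) := by
  have h1 := two_mul_T l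
  have h2 := two_mul_natCast_pentagonal (l + 1)
  rw [G, T_two_mul_add_one, show (2 * l + 1) / 2 = l by omega,
    Nat.sub_eq_iff_eq_add (by nlinarith)]
  zify at h1 ⊢
  linarith

theorem neg_one_pow_T_two_mul (l : ℕ) : (-1 : ℤ) ^ T (2 * l) = Int.negOnePow (-l) := by
  rw [T_two_mul, mul_comm, pow_mul, Odd.neg_one_pow ⟨l, rfl⟩]
  simp [Int.coe_negOnePow_natCast]

theorem neg_one_pow_T_two_mul_add_one (l : ℕ) :
    (-1 : ℤ) ^ T (2 * l + 1) = Int.negOnePow (l + 1) := by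
  rw [T_two_mul_add_one, pow_mul, Odd.neg_one_pow ⟨l, rfl⟩]
  simp [Int.negOnePow_succ, pow_succ, Int.coe_negOnePow_natCast]

theorem exists_G_eq_pentagonal (k : ℤ) : ∃ m, pentagonal k = G m := by
  rcases le_or_gt k 0 with hk | hk
  · refine ⟨2 * (-k).toNat, ?_⟩
    rw [G_two_mul]
    congr
    omega
  · refine ⟨2 * (k - 1).toNat + 1, ?_⟩
    rw [G_two_mul_add_one]
    congr
    omega

theorem coeff_pentagonalSeries_G (m : ℕ) :
    (pentagonalSeries ℤ).coeff (G m) = (-1) ^ T m := by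
  obtain ⟨l, rfl | rfl⟩ := m.even_or_odd'
  · rw [G_two_mul, coeff_pentagonalSeries_pentagonal, neg_one_pow_T_two_mul]
    rfl
  · rw [G_two_mul_add_one, coeff_pentagonalSeries_pentagonal, neg_one_pow_T_two_mul_add_one]
    rfl

theorem coeff_pentagonalSeries_eq_eps (n : ℕ) : (pentagonalSeries ℤ).coeff n = eps n := by
  by_cases h : ∃ m, n = G m
  · rw [eps, dif_pos h, ← coeff_pentagonalSeries_G, ← h.choose_spec]
  · rw [eps, dif_neg h, coeff_pentagonalSeries_eq_zero]
    rintro ⟨k, rfl⟩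
    exact h (exists_G_eq_pentagonal k)

theorem Q_of_neg {n : ℤ} (h : n < 0) : Q n = 0 := if_neg h.not_ge

theorem stmt_6 (n : ℕ) :
    Q (n : ℤ) + 2 * ∑' j : ℕ, (-1 : ℤ) ^ (j + 1) * Q ((n : ℤ) - ((j : ℤ) + 1) ^ 2) = eps n := by
  have hQ : ∀ᶠ N in atTop, ∀ i ∈ range (n + 1), (prodOneAdd (X : ℤ⟦X⟧) 1 N).coeff i = Q i :=
    (eventually_all_finset _).2 fun i _ ↦ coeff_prodOneAdd_eventually_eq i
  obtain ⟨N, hN, hE, hnN⟩ :=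
    (hQ.and ((coeff_prodOneSub_eventually_eq n).and (eventually_ge_atTop n))).exists
  have hdvd := X_pow_dvd_iff.1 (pow_dvd_partialTheta_mul_prodOneAdd_sub (X : ℤ⟦X⟧) N) n (by omega)
  rw [map_sub, sub_eq_zero, hE, coeff_pentagonalSeries_eq_eps] at hdvd
  rw [← hdvd, tsum_eq_sum (s := range N)]
  · have hterm (j : ℕ) : ((-1) ^ (j + 1) * X ^ ((j + 1) ^ 2) * prodOneAdd X 1 N : ℤ⟦X⟧).coeff n =
        (-1) ^ (j + 1) * Q ((n : ℤ) - ((j : ℤ) + 1) ^ 2) := by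
      have hC : ((-1) ^ (j + 1) : ℤ⟦X⟧) = C ((-1) ^ (j + 1)) := by simp
      rw [mul_assoc, hC, coeff_C_mul, coeff_X_pow_mul']
      congr 1
      split_ifs with h
      · rw [hN (n - (j + 1) ^ 2) (by simp)]
        push_cast [h]
        rfl
      · rw [Q_of_neg]
        zify at h
        linarith
    have h2 : (2 : ℤ⟦X⟧) = C 2 := by simp
    rw [partialTheta, add_mul, one_mul, map_add, hN n (by simp), mul_assoc, h2, coeff_C_mul,
      sum_mul, map_sum]
    simp only [hterm]
  · intro j hj
    rw [Q_of_neg, mul_zero]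
    have : (n : ℤ) ≤ j := by simp at hj; omega
    nlinarith
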